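/- Let e₁, e₂ be projections in a finite von Neumann algebra M and let E₁ = E(e₁,e₂) be the idempotent with range e₁H and kernel (1 − e₁∨e₂)H + (e₂ − e₁∧e₂)H. Then E₁ is a closed densely defined idempotent operator affiliated with W*({1,e₁,e₂}), with range projection e₁, kernel projection 1 − e₁∨e₂ + e₂ − e₁∧e₂, and E(e₁,e₂) + E(e₂,e₁) = (e₁ ∨ e₂) + (e₁ ∧ e₂). -/

import Mathlib

open scoped ComplexOrder

namespace Paper

variable {H : Type} [NormedAddCommGroup H] [InnerProductSpace ℂ H] [CompleteSpace H]

/-- `p` is an (orthogonal) projection operator. -/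
def IsProj (p : H →L[ℂ] H) : Prop := IsIdempotentElem p ∧ IsSelfAdjoint p

/-- `p` is a projection belonging to the von Neumann algebra `M`. -/
def IsProjection (M : VonNeumannAlgebra H) (p : H →L[ℂ] H) : Prop :=
  p ∈ M ∧ IsProj p

/-- The range of an operator, as a submodule. -/
def rng (p : H →L[ℂ] H) : Submodule ℂ H := LinearMap.range p.toLinearMap

/-- `r` is the lattice meet `p ∧ q` of projections: the orthogonal projection onto `pH ∩ qH`. -/
def IsMeetOf (r p q : H →L[ℂ] H) : Prop := IsProj r ∧ rng r = rng p ⊓ rng q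

/-- `r` is the lattice join `p ∨ q` of projections:
the orthogonal projection onto the closure of `pH + qH`. -/
def IsJoinOf (r p q : H →L[ℂ] H) : Prop :=
  IsProj r ∧ rng r = (rng p ⊔ rng q).topologicalClosure

/-- A faithful tracial state on a von Neumann algebra, making it a finite von Neumann algebra. -/
structure TracialState (M : VonNeumannAlgebra H) where
  τ : (H →L[ℂ] H) → ℂ
  map_add : ∀ a b : H →L[ℂ] H, τ (a + b) = τ a + τ b
  map_smul : ∀ (c : ℂ) (a : H →L[ℂ] H), τ (c • a) = c * τ a
  tracial : ∀ a b : H →L[ℂ] H, a ∈ M → b ∈ M → τ (a * b) = τ (b * a)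
  pos : ∀ a : H →L[ℂ] H, a ∈ M → 0 ≤ τ (star a * a)
  faithful : ∀ a : H →L[ℂ] H, a ∈ M → τ (star a * a) = 0 → a = 0
  normalized : τ 1 = 1

/-- `M` is diffuse: it has no minimal nonzero projections. -/
def Diffuse (M : VonNeumannAlgebra H) : Prop :=
  ∀ p : H →L[ℂ] H, IsProjection M p → p ≠ 0 →
    ∃ q : H →L[ℂ] H, IsProjection M q ∧ rng q ≤ rng p ∧ q ≠ 0 ∧ q ≠ p

end Paper

namespace Paper

variable {H : Type} [NormedAddCommGroup H] [InnerProductSpace ℂ H] [CompleteSpace H]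

/-- A closed densely defined operator `X` (given as a partially defined linear map) is
affiliated with `M` if every unitary in the commutant of `M` leaves its domain invariant and
commutes with it. -/
def Affiliated (M : VonNeumannAlgebra H) (X : H →ₗ.[ℂ] H) : Prop :=
  Dense (X.domain : Set H) ∧ IsClosed (X.graph : Set (H × H)) ∧
    ∀ u : H →L[ℂ] H, u ∈ M.commutant → u * star u = 1 → star u * u = 1 →
      ∀ x : X.domain, ∃ h : u (x : H) ∈ X.domain, X ⟨u (x : H), h⟩ = u (X x)

/-- The kernel of a partially defined operator, as a subset of `H`. -/
def kernelSet (X : H →ₗ.[ℂ] H) : Set H := {x | ∃ h : x ∈ X.domain, X ⟨x, h⟩ = 0}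

/-- The image of a set `S` under a partially defined operator. -/
def imageSet (X : H →ₗ.[ℂ] H) (S : Set H) : Set H :=
  {y | ∃ x : X.domain, (x : H) ∈ S ∧ X x = y}

/-- `k` is the kernel projection of `X`: the projection onto `ker X`. -/
def IsKerProj (X : H →ₗ.[ℂ] H) (k : H →L[ℂ] H) : Prop :=
  IsProj k ∧ (rng k : Set H) = kernelSet X

/-- `R` is the range projection of `X`: the projection onto the closure of `ran X`. -/
def IsRanProj (X : H →ₗ.[ℂ] H) (R : H →L[ℂ] H) : Prop :=
  IsProj R ∧ (rng R : Set H) = closure (imageSet X Set.univ)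

/-- `q = X♯(p)`: `q` is the range projection of `Xp`, i.e. the projection onto the closure
of `X(pH ∩ dom X)`. -/
def IsSharp (X : H →ₗ.[ℂ] H) (p q : H →L[ℂ] H) : Prop :=
  IsProj q ∧ (rng q : Set H) = closure (imageSet X (rng p : Set H))

end Paper

namespace Paper

variable {H : Type} [NormedAddCommGroup H] [InnerProductSpace ℂ H] [CompleteSpace H]

/-- `E` is the complementary idempotent `E(e₁,e₂)` of the projections `e₁, e₂`, where `j` is
the join `e₁ ∨ e₂` and `m` is the meet `e₁ ∧ e₂`: `E` has domain
`(1 − e₁∨e₂)H + e₁H + e₂H` and sends `η + ξ₁ + ξ₂ + ζ ↦ ξ₁ + ζ` for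
`η ∈ (1 − e₁∨e₂)H`, `ξᵢ ∈ (eᵢ − e₁∧e₂)H`, `ζ ∈ (e₁∧e₂)H`. -/
def IsComplIdem (e₁ e₂ j m : H →L[ℂ] H) (E : H →ₗ.[ℂ] H) : Prop :=
  E.domain = rng (1 - j) ⊔ rng e₁ ⊔ rng e₂ ∧
    ∀ η ξ₁ ξ₂ ζ : H, η ∈ rng (1 - j) → ξ₁ ∈ rng (e₁ - m) → ξ₂ ∈ rng (e₂ - m) → ζ ∈ rng m →
      ∃ h : η + ξ₁ + ξ₂ + ζ ∈ E.domain, E ⟨η + ξ₁ + ξ₂ + ζ, h⟩ = ξ₁ + ζ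

end Paper

namespace Paper

variable {H : Type} [NormedAddCommGroup H] [InnerProductSpace ℂ H]

lemma apply_mem_rng (p : H →L[ℂ] H) (x : H) : p x ∈ rng p := ⟨x, rfl⟩

lemma mapsTo_rng_of_commute {p u : H →L[ℂ] H} (h : Commute u p) :
    ∀ x ∈ rng p, u x ∈ rng p := by
  rintro _ ⟨y, rfl⟩
  exact ⟨u y, (congrArg (fun q : H →L[ℂ] H => q y) h.eq).symm⟩

lemma IsComplIdem.exists_decomp {e₁ e₂ j m : H →L[ℂ] H} {E : H →ₗ.[ℂ] H}
    (hE : IsComplIdem e₁ e₂ j m E) {x : H}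
    (hx : x ∈ E.domain) :
    ∃ η ∈ rng (1 - j), ∃ a ∈ rng e₁, ∃ b ∈ rng e₂, η + a + b = x := by
  rw [hE.1] at hx
  obtain ⟨c, hc, b, hb, rfl⟩ := Submodule.mem_sup.1 hx
  obtain ⟨η, hη, a, ha, rfl⟩ := Submodule.mem_sup.1 hc
  exact ⟨η, hη, a, ha, b, hb, rfl⟩

variable [CompleteSpace H]

lemma IsProj.one_sub {p : H →L[ℂ] H} (hp : IsProj p) : IsProj (1 - p) :=
  ⟨hp.1.one_sub, (IsSelfAdjoint.one _).sub hp.2⟩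

lemma IsProj.apply_apply {p : H →L[ℂ] H} (hp : IsProj p) (x : H) : p (p x) = p x :=
  congrArg (fun q : H →L[ℂ] H => q x) hp.1

lemma IsProj.mem_rng {p : H →L[ℂ] H} (hp : IsProj p) {x : H} : x ∈ rng p ↔ p x = x := by
  constructor
  · rintro ⟨y, rfl⟩
    exact hp.apply_apply y
  · exact fun h => ⟨x, h⟩

lemma IsProj.mem_rng_one_sub {p : H →L[ℂ] H} (hp : IsProj p) {x : H} :
    x ∈ rng (1 - p) ↔ p x = 0 := by
  simp [hp.one_sub.mem_rng]

lemma IsProj.isClosed_rng {p : H →L[ℂ] H} (hp : IsProj p) : IsClosed (rng p : Set H) := by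
  have h : (rng p : Set H) = {x | p x = x} := Set.ext fun x => hp.mem_rng
  rw [h]
  exact isClosed_eq p.continuous continuous_id

lemma IsProj.mul_eq_right {p q : H →L[ℂ] H} (hq : IsProj q) (h : rng p ≤ rng q) :
    q * p = p := by
  ext x
  exact hq.mem_rng.1 (h (apply_mem_rng p x))

lemma IsProj.mul_eq_left {p q : H →L[ℂ] H} (hp : IsProj p) (hq : IsProj q)
    (h : rng p ≤ rng q) : p * q = p := by
  have := congrArg star (hq.mul_eq_right h)
  rwa [star_mul, hp.2.star_eq, hq.2.star_eq] at this

/-- The difference of two comparable projections is a projection. -/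
lemma IsProj.sub {p q : H →L[ℂ] H} (hp : IsProj p) (hq : IsProj q) (h : rng p ≤ rng q) :
    IsProj (q - p) := by
  refine ⟨?_, hq.2.sub hp.2⟩
  have hpp : p * p = p := hp.1
  have hqq : q * q = q := hq.1
  simp [IsIdempotentElem, sub_mul, mul_sub, hpp, hqq, hq.mul_eq_right h, hp.mul_eq_left hq h]

/-- The sum of two orthogonal projections is a projection. -/
lemma IsProj.add {p q : H →L[ℂ] H} (hp : IsProj p) (hq : IsProj q) (h : p * q = 0) :
    IsProj (p + q) := by
  refine ⟨?_, hp.2.add hq.2⟩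
  have h' : q * p = 0 := by
    have := congrArg star h
    rwa [star_mul, hp.2.star_eq, hq.2.star_eq, star_zero] at this
  have hpp : p * p = p := hp.1
  have hqq : q * q = q := hq.1
  simp [IsIdempotentElem, add_mul, mul_add, hpp, hqq, h, h']

/-- An operator commutes with a projection if it and its adjoint preserve its range. -/
lemma IsProj.commute_of_mapsTo {p u : H →L[ℂ] H} (hp : IsProj p)
    (hu : ∀ x ∈ rng p, u x ∈ rng p) (hu' : ∀ x ∈ rng p, star u x ∈ rng p) : Commute u p := by
  have h₁ : p * (u * p) = u * p := by
    ext x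
    exact hp.mem_rng.1 (hu _ (apply_mem_rng p x))
  have h₂ : p * (star u * p) = star u * p := by
    ext x
    exact hp.mem_rng.1 (hu' _ (apply_mem_rng p x))
  have h₃ := congrArg star h₂
  rw [star_mul, star_mul, star_star, hp.2.star_eq, mul_assoc, h₁] at h₃
  exact h₃

lemma IsProj.commute_star {p u : H →L[ℂ] H} (hp : IsProj p) (h : Commute u p) :
    Commute (star u) p := by
  have := h.star_star
  rwa [hp.2.star_eq] at this

lemma IsMeetOf.commute {r p q u : H →L[ℂ] H} (hr : IsMeetOf r p q) (hp : IsProj p)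
    (hq : IsProj q) (hup : Commute u p) (huq : Commute u q) : Commute u r := by
  have key : ∀ v : H →L[ℂ] H, Commute v p → Commute v q → ∀ x ∈ rng r, v x ∈ rng r := by
    intro v hvp hvq x hx
    rw [hr.2] at hx ⊢
    exact ⟨mapsTo_rng_of_commute hvp x hx.1, mapsTo_rng_of_commute hvq x hx.2⟩
  exact hr.1.commute_of_mapsTo (key u hup huq)
    (key _ (hp.commute_star hup) (hq.commute_star huq))

lemma IsJoinOf.commute {r p q u : H →L[ℂ] H} (hr : IsJoinOf r p q) (hp : IsProj p)
    (hq : IsProj q) (hup : Commute u p) (huq : Commute u q) : Commute u r := by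
  have key : ∀ v : H →L[ℂ] H, Commute v p → Commute v q → ∀ x ∈ rng r, v x ∈ rng r := by
    intro v hvp hvq x hx
    rw [hr.2] at hx ⊢
    have hmaps : Set.MapsTo v (rng p ⊔ rng q : Submodule ℂ H) (rng p ⊔ rng q : Submodule ℂ H) := by
      intro y hy
      obtain ⟨a, ha, b, hb, rfl⟩ := Submodule.mem_sup.1 hy
      rw [map_add]
      exact Submodule.add_mem_sup (mapsTo_rng_of_commute hvp a ha)
        (mapsTo_rng_of_commute hvq b hb)
    exact hmaps.closure v.continuous hx
  exact hr.1.commute_of_mapsTo (key u hup huq)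
    (key _ (hp.commute_star hup) (hq.commute_star huq))

lemma IsMeetOf.symm {r p q : H →L[ℂ] H} (h : IsMeetOf r p q) : IsMeetOf r q p :=
  ⟨h.1, h.2.trans (inf_comm _ _)⟩

lemma IsJoinOf.symm {r p q : H →L[ℂ] H} (h : IsJoinOf r p q) : IsJoinOf r q p :=
  ⟨h.1, by rw [h.2, sup_comm]⟩

lemma IsMeetOf.rng_le_left {r p q : H →L[ℂ] H} (h : IsMeetOf r p q) : rng r ≤ rng p :=
  h.2.trans_le inf_le_left

lemma IsJoinOf.left_le_rng {r p q : H →L[ℂ] H} (h : IsJoinOf r p q) : rng p ≤ rng r := by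
  rw [h.2]
  exact le_sup_left.trans (Submodule.le_topologicalClosure _)

section ComplIdem

variable {e₁ e₂ j m : H →L[ℂ] H} {E : H →ₗ.[ℂ] H}

lemma isProj_kernel (he₂ : IsProj e₂) (hj : IsJoinOf j e₁ e₂) (hm : IsMeetOf m e₁ e₂) :
    IsProj (1 - j + e₂ - m) := by
  have hme := hm.symm.rng_le_left
  have hej := hj.symm.left_le_rng
  rw [add_sub_assoc]
  refine hj.1.one_sub.add (hm.1.sub he₂ hme) ?_
  simp [sub_mul, mul_sub, hj.1.mul_eq_right hej, hj.1.mul_eq_right (hme.trans hej)]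

/-- On `η + a + b` with `η ∈ (1 - e₁∨e₂)H`, `a ∈ e₁H`, `b ∈ e₂H`, the complementary idempotent
takes the value `a + (e₁∧e₂) b`. -/
lemma IsComplIdem.apply_add (he₁ : IsProj e₁) (he₂ : IsProj e₂)
    (hE : IsComplIdem e₁ e₂ j m E) {η a b : H} (hη : η ∈ rng (1 - j)) (ha : a ∈ rng e₁)
    (hb : b ∈ rng e₂) :
    ∃ h : η + a + b ∈ E.domain, E ⟨η + a + b, h⟩ = a + m b := by
  have ha' : a - m a ∈ rng (e₁ - m) := ⟨a, by simp [he₁.mem_rng.1 ha]⟩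
  have hb' : b - m b ∈ rng (e₂ - m) := ⟨b, by simp [he₂.mem_rng.1 hb]⟩
  have hx : η + (a - m a) + (b - m b) + (m a + m b) = η + a + b := by abel
  obtain ⟨h, hv⟩ := hE.2 η _ _ _ hη ha' hb' (add_mem (apply_mem_rng m a) (apply_mem_rng m b))
  simp only [hx] at h hv
  exact ⟨h, hv.trans (by abel)⟩

lemma IsComplIdem.mem_graph_iff (he₁ : IsProj e₁) (he₂ : IsProj e₂) (hj : IsJoinOf j e₁ e₂)
    (hm : IsMeetOf m e₁ e₂) (hE : IsComplIdem e₁ e₂ j m E) {x y : H} :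
    (∃ h : x ∈ E.domain, E ⟨x, h⟩ = y) ↔
      y ∈ rng e₁ ∧ x - y ∈ rng (1 - j + e₂ - m) := by
  constructor
  · rintro ⟨h, rfl⟩
    obtain ⟨η, hη, a, ha, b, hb, rfl⟩ := hE.exists_decomp h
    obtain ⟨_, hv⟩ := hE.apply_add he₁ he₂ hη ha hb
    rw [hv]
    refine ⟨add_mem ha (hm.rng_le_left (apply_mem_rng m b)), η + b, ?_⟩
    have hjη : j η = 0 := hj.1.mem_rng_one_sub.1 hη
    have heη : e₂ η = 0 := by
      rw [← he₂.mul_eq_left hj.1 hj.symm.left_le_rng]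
      simp [hjη]
    have hmη : m η = 0 := by
      rw [← hm.1.mul_eq_left he₂ hm.symm.rng_le_left]
      simp [heη]
    have hjb : j b = b := hj.1.mem_rng.1 (hj.symm.left_le_rng hb)
    have heb : e₂ b = b := he₂.mem_rng.1 hb
    simp [hjη, heη, hmη, hjb, heb]
    abel
  · rintro ⟨hy, hk⟩
    have hk' := (isProj_kernel he₂ hj hm).mem_rng.1 hk
    set w := x - y with hw
    obtain ⟨h, hv⟩ := hE.2 ((1 - j) w) (y - m y) ((e₂ - m) w) (m y) (apply_mem_rng _ _)
      ⟨y, by simp [he₁.mem_rng.1 hy]⟩ (apply_mem_rng _ _) (apply_mem_rng _ _)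
    have hx : (1 - j) w + (y - m y) + (e₂ - m) w + m y = x := by
      calc _ = (1 - j + e₂ - m) w + y := by simp; abel
        _ = x := by rw [hk', hw]; abel
    simp only [hx] at h hv
    exact ⟨h, hv.trans (by abel)⟩

lemma IsComplIdem.dense_domain (hj : IsJoinOf j e₁ e₂) (hE : IsComplIdem e₁ e₂ j m E) :
    Dense (E.domain : Set H) := by
  rw [Submodule.dense_iff_topologicalClosure_eq_top, eq_top_iff]
  intro x _
  have h₁ : rng (1 - j) ≤ E.domain.topologicalClosure := by
    refine le_trans ?_ (Submodule.le_topologicalClosure _)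
    rw [hE.1, sup_assoc]
    exact le_sup_left
  have h₂ : rng j ≤ E.domain.topologicalClosure := by
    rw [hj.2]
    apply Submodule.topologicalClosure_mono
    rw [hE.1, sup_assoc]
    exact le_sup_right
  have := add_mem (h₁ (apply_mem_rng (1 - j) x)) (h₂ (apply_mem_rng j x))
  simpa using this

lemma IsComplIdem.isClosed_graph (he₁ : IsProj e₁) (he₂ : IsProj e₂) (hj : IsJoinOf j e₁ e₂)
    (hm : IsMeetOf m e₁ e₂) (hE : IsComplIdem e₁ e₂ j m E) :
    IsClosed (E.graph : Set (H × H)) := by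
  have h : (E.graph : Set (H × H)) =
      {z | z.2 ∈ (rng e₁ : Set H)} ∩ {z | z.1 - z.2 ∈ (rng (1 - j + e₂ - m) : Set H)} := by
    ext ⟨x, y⟩
    refine Iff.trans ?_ (hE.mem_graph_iff he₁ he₂ hj hm)
    simp [LinearPMap.mem_graph_iff]
  rw [h]
  exact (he₁.isClosed_rng.preimage continuous_snd).inter
    ((isProj_kernel he₂ hj hm).isClosed_rng.preimage (continuous_fst.sub continuous_snd))

lemma IsComplIdem.affiliated (he₁ : IsProj e₁) (he₂ : IsProj e₂) (hj : IsJoinOf j e₁ e₂)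
    (hm : IsMeetOf m e₁ e₂) (hE : IsComplIdem e₁ e₂ j m E) (N : VonNeumannAlgebra H)
    (h₁ : e₁ ∈ N) (h₂ : e₂ ∈ N) : Affiliated N E := by
  refine ⟨hE.dense_domain hj, hE.isClosed_graph he₁ he₂ hj hm, ?_⟩
  rintro u hu - - ⟨x, hx⟩
  rw [VonNeumannAlgebra.mem_commutant_iff] at hu
  have hu₁ : Commute u e₁ := (hu e₁ h₁).symm
  have hu₂ : Commute u e₂ := (hu e₂ h₂).symm
  have huk : Commute u (1 - j + e₂ - m) :=
    (((Commute.one_right u).sub_right (hj.commute he₁ he₂ hu₁ hu₂)).add_right hu₂).sub_right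
      (hm.commute he₁ he₂ hu₁ hu₂)
  have hg := (hE.mem_graph_iff he₁ he₂ hj hm).1 ⟨hx, rfl⟩
  refine (hE.mem_graph_iff he₁ he₂ hj hm).2 ⟨mapsTo_rng_of_commute hu₁ _ hg.1, ?_⟩
  rw [← map_sub]
  exact mapsTo_rng_of_commute huk _ hg.2

lemma IsComplIdem.apply_of_mem_rng (he₁ : IsProj e₁) (he₂ : IsProj e₂) (hj : IsJoinOf j e₁ e₂)
    (hm : IsMeetOf m e₁ e₂) (hE : IsComplIdem e₁ e₂ j m E) {y : H} (hy : y ∈ rng e₁) :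
    ∃ h : y ∈ E.domain, E ⟨y, h⟩ = y :=
  (hE.mem_graph_iff he₁ he₂ hj hm).2 ⟨hy, by simp⟩

lemma IsComplIdem.isRanProj (he₁ : IsProj e₁) (he₂ : IsProj e₂) (hj : IsJoinOf j e₁ e₂)
    (hm : IsMeetOf m e₁ e₂) (hE : IsComplIdem e₁ e₂ j m E) : IsRanProj E e₁ := by
  have h : imageSet E Set.univ = (rng e₁ : Set H) := by
    ext y
    constructor
    · rintro ⟨⟨x, hx⟩, -, h⟩
      exact ((hE.mem_graph_iff he₁ he₂ hj hm).1 ⟨hx, h⟩).1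
    · intro hy
      obtain ⟨h, hv⟩ := hE.apply_of_mem_rng he₁ he₂ hj hm hy
      exact ⟨⟨y, h⟩, trivial, hv⟩
  refine ⟨he₁, ?_⟩
  rw [h, he₁.isClosed_rng.closure_eq]

lemma IsComplIdem.isKerProj (he₁ : IsProj e₁) (he₂ : IsProj e₂) (hj : IsJoinOf j e₁ e₂)
    (hm : IsMeetOf m e₁ e₂) (hE : IsComplIdem e₁ e₂ j m E) :
    IsKerProj E (1 - j + e₂ - m) := by
  refine ⟨isProj_kernel he₂ hj hm, ?_⟩
  ext x
  refine Iff.trans ?_ (hE.mem_graph_iff he₁ he₂ hj hm).symm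
  simp

lemma IsComplIdem.apply_add_apply {E' : H →ₗ.[ℂ] H} (he₁ : IsProj e₁) (he₂ : IsProj e₂)
    (hj : IsJoinOf j e₁ e₂) (hm : IsMeetOf m e₁ e₂) (hE : IsComplIdem e₁ e₂ j m E)
    (hE' : IsComplIdem e₂ e₁ j m E') (x : H) (h : x ∈ E.domain) (h' : x ∈ E'.domain) :
    E ⟨x, h⟩ + E' ⟨x, h'⟩ = (j + m) x := by
  obtain ⟨η, hη, a, ha, b, hb, rfl⟩ := hE.exists_decomp h
  obtain ⟨_, hv⟩ := hE.apply_add he₁ he₂ hη ha hb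
  obtain ⟨_, hv'⟩ := hE'.apply_add he₂ he₁ hη hb ha
  simp only [add_right_comm η b a] at hv'
  have hjη : j η = 0 := hj.1.mem_rng_one_sub.1 hη
  have hmη : m η = 0 := by
    rw [← hm.1.mul_eq_left hj.1 (hm.rng_le_left.trans hj.left_le_rng)]
    simp [hjη]
  have hja : j a = a := hj.1.mem_rng.1 (hj.left_le_rng ha)
  have hjb : j b = b := hj.1.mem_rng.1 (hj.symm.left_le_rng hb)
  rw [hv, hv']
  simp [hjη, hmη, hja, hjb]
  abel

end ComplIdem

end Paper

/-- Let `e₁, e₂` be projections in a finite von Neumann algebra `M`, and let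
`E₁ = E(e₁,e₂)` be the idempotent with range `e₁H` and kernel
`(1 − e₁∨e₂)H + (e₂ − e₁∧e₂)H`.  Then `E₁` is a closed densely defined idempotent operator
affiliated with `W*({1,e₁,e₂})` (i.e. with every von Neumann algebra containing `e₁,e₂`),
with range projection `e₁`, kernel projection `1 − e₁∨e₂ + e₂ − e₁∧e₂`, and
`E(e₁,e₂) + E(e₂,e₁) = (e₁ ∨ e₂) + (e₁ ∧ e₂)`. -/
theorem complIdem_properties {H : Type} [NormedAddCommGroup H] [InnerProductSpace ℂ H]
    [CompleteSpace H] (M : VonNeumannAlgebra H)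
    (e₁ e₂ j m : H →L[ℂ] H)
    (he₁ : Paper.IsProjection M e₁) (he₂ : Paper.IsProjection M e₂)
    (hj : Paper.IsJoinOf j e₁ e₂) (hm : Paper.IsMeetOf m e₁ e₂)
    (E₁ E₂ : H →ₗ.[ℂ] H)
    (hE₁ : Paper.IsComplIdem e₁ e₂ j m E₁) (hE₂ : Paper.IsComplIdem e₂ e₁ j m E₂) :
    -- E₁ is densely defined and closed:
    Dense (E₁.domain : Set H) ∧ IsClosed (E₁.graph : Set (H × H)) ∧
    -- E₁ is idempotent:
    (∀ (x : H) (h : x ∈ E₁.domain),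
      ∃ h' : E₁ ⟨x, h⟩ ∈ E₁.domain, E₁ ⟨E₁ ⟨x, h⟩, h'⟩ = E₁ ⟨x, h⟩) ∧
    -- E₁ is affiliated with every von Neumann algebra containing e₁ and e₂:
    (∀ N : VonNeumannAlgebra H, e₁ ∈ N → e₂ ∈ N → Paper.Affiliated N E₁) ∧
    -- the range projection of E₁ is e₁:
    Paper.IsRanProj E₁ e₁ ∧
    -- the kernel projection of E₁ is 1 − e₁∨e₂ + e₂ − e₁∧e₂:
    Paper.IsKerProj E₁ (1 - j + e₂ - m) ∧
    -- E(e₁,e₂) + E(e₂,e₁) = (e₁ ∨ e₂) + (e₁ ∧ e₂):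
    (∀ (x : H) (h₁ : x ∈ E₁.domain) (h₂ : x ∈ E₂.domain),
      E₁ ⟨x, h₁⟩ + E₂ ⟨x, h₂⟩ = (j + m) x) := by
  exact ⟨hE₁.dense_domain hj, hE₁.isClosed_graph he₁.2 he₂.2 hj hm,
    fun x h => hE₁.apply_of_mem_rng he₁.2 he₂.2 hj hm
      ((hE₁.mem_graph_iff he₁.2 he₂.2 hj hm).1 ⟨h, rfl⟩).1,
    hE₁.affiliated he₁.2 he₂.2 hj hm, hE₁.isRanProj he₁.2 he₂.2 hj hm,
    hE₁.isKerProj he₁.2 he₂.2 hj hm, hE₁.apply_add_apply he₁.2 he₂.2 hj hm hE₂⟩
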